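/- arXiv:1904.11585 — 4 statements merged into one kernel-verified Lean document; each statement's English description precedes it below -/
import Mathlib

section
/- Let m be a quadratic model m(x_k + s) = m(x_k) + gᵀs + (1/2) sᵀH s with g ≠ 0 and H symmetric, and let Δ > 0. Define the Cauchy step s^C = −t^C g, where t^C minimizes t ↦ m(x_k − t g) over {t ≥ 0 : t‖g‖ ≤ Δ}. Then m(x_k) − m(x_k + s^C) ≥ (1/2) ‖g‖ · min{‖g‖/‖H‖, Δ}, where ‖H‖ is the operator norm of H and the ratio ‖g‖/‖H‖ is interpreted as +∞ when H = 0. -/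
open scoped RealInnerProductSpace

/-- A step of length `d` along `-g` decreases a quadratic model by at least `‖g‖ * d / 2`
whenever `d * ‖H‖ ≤ ‖g‖`. -/
theorem half_norm_mul_le_quadratic_decrease {E : Type*} [NormedAddCommGroup E]
    [InnerProductSpace ℝ E] {m : E → ℝ} {x g : E} {H : E →L[ℝ] E} (hg : g ≠ 0)
    (hm : ∀ s : E, m (x + s) = m x + ⟪g, s⟫ + (1 / 2) * ⟪s, H s⟫)
    {d : ℝ} (hd : 0 ≤ d) (hdH : d * ‖H‖ ≤ ‖g‖) :
    (1 / 2) * ‖g‖ * d ≤ m x - m (x - (d / ‖g‖) • g) := by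
  have hg' : 0 < ‖g‖ := norm_pos_iff.mpr hg
  have hlin : ⟪g, -((d / ‖g‖) • g)⟫ = -(d * ‖g‖) := by
    rw [inner_neg_right, real_inner_smul_right, real_inner_self_eq_norm_sq]
    field_simp
  have hnorm : ‖-((d / ‖g‖) • g)‖ = d := by
    rw [norm_neg, norm_smul, Real.norm_of_nonneg (by positivity)]
    field_simp
  have hquad : ⟪-((d / ‖g‖) • g), H (-((d / ‖g‖) • g))⟫ ≤ d * (‖H‖ * d) := by
    refine (real_inner_le_norm _ _).trans ?_
    have hle := H.le_opNorm (-((d / ‖g‖) • g))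
    rw [hnorm] at hle ⊢
    exact mul_le_mul_of_nonneg_left hle hd
  rw [sub_eq_add_neg x, hm, hlin]
  have hmul := mul_le_mul_of_nonneg_left hdH hd
  linarith

/-- For a quadratic model `m(x_k + s) = m(x_k) + ⟪g, s⟫ + (1/2)⟪s, H s⟫`
with `g ≠ 0` and symmetric `H`, the Cauchy step `s^C = -t^C g` (where `t^C` minimizes
`t ↦ m(x_k - t g)` over `{t ≥ 0 : t‖g‖ ≤ Δ}`) satisfies the Cauchy decrease condition
`m(x_k) - m(x_k + s^C) ≥ (1/2)‖g‖ min{‖g‖/‖H‖, Δ}`, where the ratio `‖g‖/‖H‖` is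
interpreted as `+∞` (so the minimum is `Δ`) when `H = 0`. -/
theorem cauchy_decrease {n : ℕ}
    (m : EuclideanSpace ℝ (Fin n) → ℝ)
    (xk g : EuclideanSpace ℝ (Fin n))
    (H : EuclideanSpace ℝ (Fin n) →L[ℝ] EuclideanSpace ℝ (Fin n))
    (hsymm : ∀ u v : EuclideanSpace ℝ (Fin n), ⟪H u, v⟫ = ⟪u, H v⟫)
    (hg : g ≠ 0) (Δ : ℝ) (hΔ : 0 < Δ)
    (hm : ∀ s : EuclideanSpace ℝ (Fin n),
      m (xk + s) = m xk + ⟪g, s⟫ + (1 / 2) * ⟪s, H s⟫)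
    (tC : ℝ) (htC0 : 0 ≤ tC) (htCΔ : tC * ‖g‖ ≤ Δ)
    (htCmin : ∀ t : ℝ, 0 ≤ t → t * ‖g‖ ≤ Δ → m (xk - tC • g) ≤ m (xk - t • g)) :
    (H = 0 → (1 / 2) * ‖g‖ * Δ ≤ m xk - m (xk + -(tC • g))) ∧
    (H ≠ 0 → (1 / 2) * ‖g‖ * min (‖g‖ / ‖H‖) Δ ≤ m xk - m (xk + -(tC • g))) := by
  have hg' : 0 < ‖g‖ := norm_pos_iff.mpr hg
  have decrease : ∀ d : ℝ, 0 ≤ d → d ≤ Δ → d * ‖H‖ ≤ ‖g‖ →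
      (1 / 2) * ‖g‖ * d ≤ m xk - m (xk + -(tC • g)) := by
    intro d hd hdΔ hdH
    have hmin := htCmin (d / ‖g‖) (by positivity) (by rwa [div_mul_cancel₀ d hg'.ne'])
    rw [← sub_eq_add_neg]
    linarith [half_norm_mul_le_quadratic_decrease hg hm hd hdH]
  refine ⟨fun hH => decrease Δ hΔ.le le_rfl (by simp [hH]), fun hH => ?_⟩
  have hH' : 0 < ‖H‖ := norm_pos_iff.mpr hH
  exact decrease _ (le_min (by positivity) hΔ.le) (min_le_right _ _)
    ((le_div_iff₀ hH').mp (min_le_left _ _))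
end

section
/- Let f : ℝⁿ → ℝ be Lipschitz continuous, let B be a symmetric positive-definite matrix, and let μ > 0. Then the Gaussian smoothed function f_μ is differentiable at every x ∈ ℝⁿ, with gradient ∇f_μ(x) = (1/μ) √(det B/(2π)ⁿ) ∫_{ℝⁿ} (f(x + μu) − f(x)) exp(−(1/2) uᵀBu) B u du. -/
open MeasureTheory

open scoped InnerProductSpace

section GaussianWeight

variable {E : Type*} [NormedAddCommGroup E] [InnerProductSpace ℝ E]

/-- A positive operator on a finite-dimensional space is coercive. -/
lemma exists_coercivity_const [FiniteDimensional ℝ E] (A : E →L[ℝ] E)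
    (hA : ∀ u, u ≠ 0 → 0 < ⟪A u, u⟫_ℝ) :
    ∃ c > 0, ∀ u, c * ‖u‖ ^ 2 ≤ ⟪A u, u⟫_ℝ := by
  rcases subsingleton_or_nontrivial E with hE | hE
  · exact ⟨1, one_pos, fun u => by simp [Subsingleton.elim u 0]⟩
  obtain ⟨v, hv, hmin⟩ := (isCompact_sphere (0 : E) 1).exists_isMinOn
    (NormedSpace.sphere_nonempty.2 zero_le_one)
    (f := fun u => ⟪A u, u⟫_ℝ) (by fun_prop)
  refine ⟨⟪A v, v⟫_ℝ, hA v (ne_zero_of_mem_unit_sphere ⟨v, hv⟩), fun u => ?_⟩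
  rcases eq_or_ne u 0 with rfl | hu
  · simp
  have hu' : ‖u‖ ≠ 0 := norm_ne_zero_iff.2 hu
  have h : ⟪A v, v⟫_ℝ ≤ ⟪A (‖u‖⁻¹ • u), ‖u‖⁻¹ • u⟫_ℝ :=
    hmin (by simp [norm_smul, hu'])
  simp only [map_smul, real_inner_smul_left, real_inner_smul_right] at h
  calc ⟪A v, v⟫_ℝ * ‖u‖ ^ 2 ≤ ‖u‖⁻¹ * (‖u‖⁻¹ * ⟪A u, u⟫_ℝ) * ‖u‖ ^ 2 := by gcongr
    _ = ⟪A u, u⟫_ℝ := by field_simp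

lemma hasFDerivAt_gaussian_translate (A : E →L[ℝ] E)
    (hA : (A : E →ₗ[ℝ] E).IsSymmetric) (v w : E) :
    HasFDerivAt (fun w => Real.exp (-(1 / 2) * ⟪A (v - w), v - w⟫_ℝ))
      (Real.exp (-(1 / 2) * ⟪A (v - w), v - w⟫_ℝ) • innerSL ℝ (A (v - w))) w := by
  have hsub : HasFDerivAt (fun w => v - w) (-ContinuousLinearMap.id ℝ E) w :=
    (hasFDerivAt_id w).const_sub v
  have hq : HasFDerivAt (fun w => -(1 / 2) * ⟪A (v - w), v - w⟫_ℝ)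
      (innerSL ℝ (A (v - w))) w := by
    convert! (((A.hasFDerivAt.comp w hsub).inner ℝ hsub).const_mul (-(1 / 2) : ℝ)) using 1
    ext y
    have hsymm := hA (v - w) y
    simp [fderivInnerCLM_apply, inner_sub_left, real_inner_comm _ (A y)] at hsymm ⊢
    linarith
  exact hq.exp

lemma exp_neg_form_translate_le {A : E →L[ℝ] E} {c : ℝ} (hc : 0 < c)
    (hAc : ∀ u, c * ‖u‖ ^ 2 ≤ ⟪A u, u⟫_ℝ) {v w : E} (hw : ‖w‖ ≤ 1) :
    Real.exp (-(1 / 2) * ⟪A (v - w), v - w⟫_ℝ) ≤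
      Real.exp (c / 2) * Real.exp (-(c / 4) * ‖v‖ ^ 2) := by
  rw [← Real.exp_add]
  refine Real.exp_le_exp.2 ?_
  have h1 : ‖v‖ ≤ ‖v - w‖ + 1 := by linarith [norm_le_norm_sub_add v w]
  have h2 : ‖v‖ ^ 2 ≤ 2 * ‖v - w‖ ^ 2 + 2 := by
    nlinarith [sq_nonneg (‖v - w‖ - 1), norm_nonneg v, norm_nonneg (v - w)]
  nlinarith [hAc (v - w), mul_le_mul_of_nonneg_left h2 hc.le]

variable [FiniteDimensional ℝ E] [MeasurableSpace E] [BorelSpace E]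

lemma integrable_one_add_norm_sq_mul_exp_neg_norm_sq {a : ℝ} (ha : 0 < a) :
    Integrable (fun v : E => (1 + ‖v‖) ^ 2 * Real.exp (-a * ‖v‖ ^ 2)) := by
  have hint : Integrable (fun v : E => Real.exp (-(a / 2) * ‖v‖ ^ 2)) := by
    have h := (GaussianFourier.integrable_cexp_neg_mul_sq_norm_add (V := E)
      (b := ((a / 2 : ℝ) : ℂ)) (by simpa using ha) 0 0).norm
    refine h.congr (.of_forall fun v => ?_)
    simp [Complex.norm_exp, ← Complex.ofReal_pow]
  refine (hint.const_mul (2 + 4 / a)).mono' (by fun_prop) (.of_forall fun v => ?_)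
  rw [Real.norm_of_nonneg (by positivity)]
  have h1 : (1 : ℝ) ≤ Real.exp (a / 2 * ‖v‖ ^ 2) := Real.one_le_exp (by positivity)
  have h2 : a / 2 * ‖v‖ ^ 2 ≤ Real.exp (a / 2 * ‖v‖ ^ 2) := by
    linarith [Real.add_one_le_exp (a / 2 * ‖v‖ ^ 2)]
  have hpoly : (1 + ‖v‖) ^ 2 ≤ (2 + 4 / a) * Real.exp (a / 2 * ‖v‖ ^ 2) := by
    calc (1 + ‖v‖) ^ 2 ≤ 2 * 1 + 4 / a * (a / 2 * ‖v‖ ^ 2) := by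
          field_simp
          nlinarith [sq_nonneg (1 - ‖v‖)]
      _ ≤ 2 * Real.exp (a / 2 * ‖v‖ ^ 2) + 4 / a * Real.exp (a / 2 * ‖v‖ ^ 2) := by gcongr
      _ = _ := by ring
  calc (1 + ‖v‖) ^ 2 * Real.exp (-a * ‖v‖ ^ 2)
      ≤ (2 + 4 / a) * Real.exp (a / 2 * ‖v‖ ^ 2) * Real.exp (-a * ‖v‖ ^ 2) := by gcongr
    _ = (2 + 4 / a) * Real.exp (-(a / 2) * ‖v‖ ^ 2) := by
        rw [mul_assoc, ← Real.exp_add]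
        ring_nf

/-- Correlating a function of linear growth with a Gaussian weight can be differentiated under the
integral sign, all derivatives falling on the weight. -/
lemma integrable_and_hasFDerivAt_integral_gaussian_translate {A : E →L[ℝ] E}
    (hA : (A : E →ₗ[ℝ] E).IsSymmetric) {c : ℝ} (hc : 0 < c)
    (hAc : ∀ u, c * ‖u‖ ^ 2 ≤ ⟪A u, u⟫_ℝ) {g : E → ℝ} (hg : Continuous g) {C : ℝ}
    (hgC : ∀ v, |g v| ≤ C * (1 + ‖v‖)) :
    Integrable (fun v => (g v * Real.exp (-(1 / 2) * ⟪A v, v⟫_ℝ)) • A v) ∧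
      HasFDerivAt (fun w => ∫ v, g v * Real.exp (-(1 / 2) * ⟪A (v - w), v - w⟫_ℝ))
        (innerSL ℝ (∫ v, (g v * Real.exp (-(1 / 2) * ⟪A v, v⟫_ℝ)) • A v)) 0 := by
  have hC : 0 ≤ C := by simpa using (abs_nonneg _).trans (hgC 0)
  have hle : ∀ v w : E, ‖w‖ ≤ 1 → |g v * Real.exp (-(1 / 2) * ⟪A (v - w), v - w⟫_ℝ)| ≤
      C * (1 + ‖v‖) * (Real.exp (c / 2) * Real.exp (-(c / 4) * ‖v‖ ^ 2)) := fun v w hw => by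
    rw [abs_mul, Real.abs_exp]
    exact mul_le_mul (hgC v) (exp_neg_form_translate_le hc hAc hw) (Real.exp_pos _).le
      (by positivity)
  have hbase := integrable_one_add_norm_sq_mul_exp_neg_norm_sq (E := E) (a := c / 4) (by positivity)
  have hbound : ∀ v w : E, ‖w‖ ≤ 1 →
      ‖(g v * Real.exp (-(1 / 2) * ⟪A (v - w), v - w⟫_ℝ)) • A (v - w)‖ ≤
        C * Real.exp (c / 2) * ‖A‖ * ((1 + ‖v‖) ^ 2 * Real.exp (-(c / 4) * ‖v‖ ^ 2)) :=
    fun v w hw => by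
      have hAv : ‖A (v - w)‖ ≤ ‖A‖ * (1 + ‖v‖) :=
        (A.le_opNorm _).trans (by gcongr; linarith [norm_sub_le v w])
      rw [norm_smul, Real.norm_eq_abs]
      calc _ ≤ C * (1 + ‖v‖) * (Real.exp (c / 2) * Real.exp (-(c / 4) * ‖v‖ ^ 2)) *
            (‖A‖ * (1 + ‖v‖)) := by
              gcongr
              exact hle v w hw
        _ = _ := by ring
  have hint : Integrable (fun v => (g v * Real.exp (-(1 / 2) * ⟪A v, v⟫_ℝ)) • A v) := by
    refine (hbase.const_mul (C * Real.exp (c / 2) * ‖A‖)).mono'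
      (Continuous.aestronglyMeasurable (by fun_prop)) (.of_forall fun v => ?_)
    simpa using hbound v 0 (by simp)
  refine ⟨hint, ?_⟩
  have key := hasFDerivAt_integral_of_dominated_of_fderiv_le (μ := (volume : Measure E)) (𝕜 := ℝ)
    (F := fun w v => g v * Real.exp (-(1 / 2) * ⟪A (v - w), v - w⟫_ℝ))
    (F' := fun w v => innerSL ℝ
      ((g v * Real.exp (-(1 / 2) * ⟪A (v - w), v - w⟫_ℝ)) • A (v - w)))
    (x₀ := (0 : E)) (Metric.ball_mem_nhds (0 : E) one_pos)
    (bound := fun v => C * Real.exp (c / 2) * ‖A‖ *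
      ((1 + ‖v‖) ^ 2 * Real.exp (-(c / 4) * ‖v‖ ^ 2)))
    (.of_forall fun w => Continuous.aestronglyMeasurable (by fun_prop))
    ((hbase.const_mul (C * Real.exp (c / 2))).mono'
      (Continuous.aestronglyMeasurable (by fun_prop)) (.of_forall fun v => by
        refine (hle v 0 (by simp)).trans ?_
        have : 1 + ‖v‖ ≤ (1 + ‖v‖) ^ 2 := by nlinarith [norm_nonneg v]
        calc _ = C * Real.exp (c / 2) * ((1 + ‖v‖) * Real.exp (-(c / 4) * ‖v‖ ^ 2)) := by ring
          _ ≤ _ := by gcongr))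
    (Continuous.aestronglyMeasurable (by fun_prop))
    (.of_forall fun v w hw => by
      rw [innerSL_apply_norm]
      exact hbound v w (mem_ball_zero_iff.1 hw).le)
    (hbase.const_mul _)
    (.of_forall fun v w _ => by
      convert! (hasFDerivAt_gaussian_translate A hA v w).const_mul (g v) using 1
      ext y
      simp [mul_assoc])
  convert! key using 1
  simp only [sub_zero]
  exact ((innerSL ℝ : E →L[ℝ] E →L[ℝ] ℝ).integral_comp_comm hint).symm

lemma hasGradientAt_integral_gaussian_smoothing {A : E →L[ℝ] E}
    (hA : (A : E →ₗ[ℝ] E).IsSymmetric) (hpos : ∀ u, u ≠ 0 → 0 < ⟪A u, u⟫_ℝ)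
    {f : E → ℝ} {K : NNReal} (hf : LipschitzWith K f) {μ : ℝ} (hμ : μ ≠ 0) (x : E) :
    HasGradientAt (fun z => ∫ u, f (z + μ • u) * Real.exp (-(1 / 2) * ⟪A u, u⟫_ℝ))
      (μ⁻¹ • ∫ u, ((f (x + μ • u) - f x) * Real.exp (-(1 / 2) * ⟪A u, u⟫_ℝ)) • A u) x := by
  obtain ⟨c, hc, hAc⟩ := exists_coercivity_const A hpos
  have hcont := hf.continuous
  have hgrowth : ∀ v, |f (x + μ • v)| ≤ (|f x| + K * |μ|) * (1 + ‖v‖) := fun v => by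
    have h : |f (x + μ • v) - f x| ≤ K * (|μ| * ‖v‖) := by
      simpa [Real.dist_eq, norm_smul] using hf.dist_le_mul (x + μ • v) x
    have := abs_sub_abs_le_abs_sub (f (x + μ • v)) (f x)
    have h1 : 0 ≤ |f x| * ‖v‖ := by positivity
    have h2 : 0 ≤ K * |μ| := by positivity
    linarith
  obtain ⟨hint, hderiv⟩ := integrable_and_hasFDerivAt_integral_gaussian_translate hA hc hAc
    (g := fun v => f (x + μ • v)) (by fun_prop) hgrowth
  obtain ⟨hint', -⟩ := integrable_and_hasFDerivAt_integral_gaussian_translate hA hc hAc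
    (g := fun _ => f x) (by fun_prop) (C := |f x|)
    (fun v => le_mul_of_one_le_right (abs_nonneg _) (by simp))
  have hodd : ∫ u, (f x * Real.exp (-(1 / 2) * ⟪A u, u⟫_ℝ)) • A u = 0 := by
    have h := integral_neg_eq_self
      (fun u => (f x * Real.exp (-(1 / 2) * ⟪A u, u⟫_ℝ)) • A u) volume
    simp only [map_neg, inner_neg_neg, smul_neg, integral_neg] at h
    have : IsAddTorsionFree E := .of_isTorsionFree ℝ E
    exact neg_eq_self.1 h
  have hgrad : ∫ u, ((f (x + μ • u) - f x) * Real.exp (-(1 / 2) * ⟪A u, u⟫_ℝ)) • A u =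
      ∫ u, (f (x + μ • u) * Real.exp (-(1 / 2) * ⟪A u, u⟫_ℝ)) • A u := by
    simp only [sub_mul, sub_smul]
    rw [integral_sub hint hint', hodd, sub_zero]
  have hshift : ∀ z, ∫ u, f (z + μ • u) * Real.exp (-(1 / 2) * ⟪A u, u⟫_ℝ) =
      ∫ v, f (x + μ • v) * Real.exp (-(1 / 2) *
        ⟪A (v - μ⁻¹ • (z - x)), v - μ⁻¹ • (z - x)⟫_ℝ) := fun z => by
    rw [← integral_sub_right_eq_self _ (μ⁻¹ • (z - x))]
    refine integral_congr_ae (.of_forall fun v => ?_)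
    have hv : z + μ • (v - μ⁻¹ • (z - x)) = x + μ • v := by
      rw [smul_sub, smul_inv_smul₀ hμ]
      abel
    simp only [hv]
  have hinner : HasFDerivAt (fun z => μ⁻¹ • (z - x)) (μ⁻¹ • ContinuousLinearMap.id ℝ E) x :=
    ((hasFDerivAt_id x).sub_const x).const_smul μ⁻¹
  rw [hasGradientAt_iff_hasFDerivAt, hgrad, funext hshift]
  rw [show (0 : E) = μ⁻¹ • (x - x) by simp] at hderiv
  refine (HasFDerivAt.comp x hderiv hinner).congr_fderiv ?_
  ext y
  simp

end GaussianWeight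

lemma Matrix.sum_sum_eq_inner_toEuclideanCLM {n : ℕ} (B : Matrix (Fin n) (Fin n) ℝ)
    (u : EuclideanSpace ℝ (Fin n)) :
    ∑ i, ∑ j, u i * B i j * u j = ⟪Matrix.toEuclideanCLM (𝕜 := ℝ) B u, u⟫_ℝ := by
  rw [real_inner_comm, Matrix.inner_toEuclideanCLM]
  simp [dotProduct, Matrix.mulVec, Finset.mul_sum, mul_assoc]

open MeasureTheory

/-- If `f : ℝⁿ → ℝ` is Lipschitz continuous, `B` is symmetric
positive-definite and `μ > 0`, then the Gaussian smoothed function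
`f_μ(x) = √(det B/(2π)ⁿ) ∫ f(x + μu) exp(-(1/2) uᵀBu) du` is differentiable everywhere with
`∇f_μ(x) = (1/μ) √(det B/(2π)ⁿ) ∫ (f(x + μu) - f(x)) exp(-(1/2) uᵀBu) B u du`. -/
theorem gaussian_smoothing_gradient {n : ℕ}
    (f : EuclideanSpace ℝ (Fin n) → ℝ) (Lf : NNReal)
    (hf : LipschitzWith Lf f)
    (B : Matrix (Fin n) (Fin n) ℝ) (hB : B.PosDef)
    (μ : ℝ) (hμ : 0 < μ) :
    ∀ x : EuclideanSpace ℝ (Fin n),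
      HasGradientAt
        (fun z : EuclideanSpace ℝ (Fin n) =>
          Real.sqrt (B.det / (2 * Real.pi) ^ n) *
            ∫ u : EuclideanSpace ℝ (Fin n),
              f (z + μ • u) * Real.exp (-(1 / 2) * ∑ i, ∑ j, u i * B i j * u j))
        ((μ⁻¹ * Real.sqrt (B.det / (2 * Real.pi) ^ n)) •
          ∫ u : EuclideanSpace ℝ (Fin n),
            ((f (x + μ • u) - f x) *
                Real.exp (-(1 / 2) * ∑ i, ∑ j, u i * B i j * u j)) •
              (EuclideanSpace.equiv (Fin n) ℝ).symm (B.mulVec fun i => u i))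
        x := by
  intro x
  set A := Matrix.toEuclideanCLM (𝕜 := ℝ) B
  have hA : (A : EuclideanSpace ℝ (Fin n) →ₗ[ℝ] EuclideanSpace ℝ (Fin n)).IsSymmetric := by
    rw [Matrix.coe_toEuclideanCLM_eq_toEuclideanLin]
    exact Matrix.isSymmetric_toEuclideanLin_iff.2 hB.isHermitian
  have hpos : ∀ u, u ≠ 0 → 0 < ⟪A u, u⟫_ℝ := fun u hu => by
    rw [real_inner_comm, Matrix.inner_toEuclideanCLM]
    simpa using hB.dotProduct_mulVec_pos (x := u.ofLp) (by simpa using hu)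
  have h := hasGradientAt_integral_gaussian_smoothing hA hpos hf hμ.ne' x
  simp only [Matrix.sum_sum_eq_inner_toEuclideanCLM]
  rw [hasGradientAt_iff_hasFDerivAt] at h ⊢
  convert! h.const_mul (Real.sqrt (B.det / (2 * Real.pi) ^ n)) using 1
  rw [mul_comm, mul_smul, map_smul]
  rfl
end

section
/- Let f : ℝⁿ → ℝ be differentiable with gradient Lipschitz continuous with constant L_g. Then for every μ > 0 and every symmetric positive-definite matrix B, the Gaussian smoothed function f_μ is differentiable with gradient Lipschitz continuous with constant at most L_g; moreover ∇f_μ(x) = √(det B/(2π)ⁿ) ∫_{ℝⁿ} ∇f(x + μu) exp(−(1/2) uᵀBu) du. -/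
open MeasureTheory

theorem integrable_norm_of_integrable_norm_sq {E : Type*} [NormedAddCommGroup E]
    [MeasurableSpace E] [BorelSpace E] {ν : Measure E} [IsFiniteMeasure ν]
    (hν : Integrable (fun u : E ↦ ‖u‖ ^ 2) ν) :
    Integrable (fun u : E ↦ ‖u‖) ν :=
  (hν.add (integrable_const 1)).mono' (by fun_prop) <| .of_forall fun u ↦ by
    simp only [norm_norm, Pi.add_apply]
    nlinarith [sq_nonneg (‖u‖ - 1)]

section Smoothing

variable {E : Type*} [NormedAddCommGroup E] [InnerProductSpace ℝ E]

theorem norm_le_of_lipschitz_gradient [CompleteSpace E] {f : E → ℝ} {gf : E → E}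
    (hgrad : ∀ x, HasGradientAt f (gf x) x) {L : NNReal} (hLip : LipschitzWith L gf) (x h : E) :
    ‖f (x + h)‖ ≤ ‖f x‖ + (‖gf x‖ + L * ‖h‖) * ‖h‖ := by
  have hbound : ∀ y ∈ Metric.closedBall x ‖h‖,
      ‖InnerProductSpace.toDual ℝ E (gf y)‖ ≤ ‖gf x‖ + L * ‖h‖ := fun y hy ↦ by
    rw [LinearIsometryEquiv.norm_map]
    calc ‖gf y‖ ≤ ‖gf x‖ + ‖gf y - gf x‖ := norm_le_insert' _ _
      _ ≤ ‖gf x‖ + L * ‖h‖ := by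
        gcongr
        exact (hLip.norm_sub_le y x).trans (by gcongr; exact mem_closedBall_iff_norm.1 hy)
  have hmvt := Convex.norm_image_sub_le_of_norm_hasFDerivWithin_le
    (fun y _ ↦ (hgrad y).hasFDerivAt.hasFDerivWithinAt) hbound (convex_closedBall x ‖h‖)
    (Metric.mem_closedBall_self (norm_nonneg h)) (y := x + h) (by simp)
  rw [add_sub_cancel_left] at hmvt
  exact (norm_le_insert' _ _).trans (by gcongr)

variable [MeasurableSpace E] [BorelSpace E] [SecondCountableTopology E]
  {ν : Measure E} [IsProbabilityMeasure ν]

theorem integrable_lipschitz_comp_add_smul {gf : E → E} {L : NNReal} (hLip : LipschitzWith L gf)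
    (hν : Integrable (fun u : E ↦ ‖u‖) ν) (c : ℝ) (x : E) :
    Integrable (fun u ↦ gf (x + c • u)) ν := by
  have := hLip.continuous
  refine ((integrable_const ‖gf x‖).add (hν.const_mul (L * |c|))).mono'
    (by fun_prop) (.of_forall fun u ↦ ?_)
  have h := hLip.norm_sub_le (x + c • u) x
  rw [add_sub_cancel_left, norm_smul, Real.norm_eq_abs, ← mul_assoc] at h
  simpa using (norm_le_insert' _ (gf x)).trans (add_le_add_right h _)

theorem hasGradientAt_integral_comp_add_smul [CompleteSpace E] {f : E → ℝ} {gf : E → E}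
    (hgrad : ∀ x, HasGradientAt f (gf x) x) {L : NNReal} (hLip : LipschitzWith L gf)
    (hν : Integrable (fun u : E ↦ ‖u‖ ^ 2) ν) (c : ℝ) (x : E) :
    HasGradientAt (fun z ↦ ∫ u, f (z + c • u) ∂ν) (∫ u, gf (x + c • u) ∂ν) x := by
  have hν₁ := integrable_norm_of_integrable_norm_sq hν
  have hf : Continuous f := continuous_iff_continuousAt.2 fun y ↦ (hgrad y).continuousAt
  have hgf := hLip.continuous
  have hint : Integrable (fun u ↦ f (x + c • u)) ν := by
    refine (((integrable_const ‖f x‖).add (hν₁.const_mul (‖gf x‖ * |c|))).add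
      (hν.const_mul (L * |c| ^ 2))).mono' (by fun_prop) (.of_forall fun u ↦ ?_)
    have h := norm_le_of_lipschitz_gradient hgrad hLip x (c • u)
    rw [norm_smul c u, Real.norm_eq_abs c] at h
    simp only [Pi.add_apply]
    linarith
  have hderiv := hasFDerivAt_integral_of_dominated_of_fderiv_le (μ := ν) (𝕜 := ℝ)
    (F := fun z u ↦ f (z + c • u))
    (F' := fun z u ↦ InnerProductSpace.toDual ℝ E (gf (z + c • u)))
    (bound := fun u ↦ ‖gf x‖ + L * (1 + |c| * ‖u‖)) (Metric.ball_mem_nhds x one_pos)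
    (.of_forall fun z ↦ by fun_prop) hint
    (((InnerProductSpace.toDual ℝ E).continuous.comp
      (by fun_prop : Continuous fun u ↦ gf (x + c • u))).aestronglyMeasurable)
    (.of_forall fun u z hz ↦ ?_)
    ((integrable_const _).add (((integrable_const _).add (hν₁.const_mul _)).const_mul _))
    (.of_forall fun u z _ ↦ (hasFDerivAt_comp_add_right (c • u)).2 (hgrad (z + c • u)).hasFDerivAt)
  · rw [hasGradientAt_iff_hasFDerivAt]
    have hdual : Integrable (fun u ↦ InnerProductSpace.toDual ℝ E (gf (x + c • u))) ν :=
      (integrable_lipschitz_comp_add_smul hLip hν₁ c x).mono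
        ((InnerProductSpace.toDual ℝ E).continuous.comp
          (by fun_prop : Continuous fun u ↦ gf (x + c • u))).aestronglyMeasurable
        (.of_forall fun u ↦ (LinearIsometryEquiv.norm_map _ _).le)
    convert! hderiv using 1
    ext v
    rw [ContinuousLinearMap.integral_apply hdual]
    simp only [InnerProductSpace.toDual_apply_apply]
    simp_rw [real_inner_comm v]
    exact (integral_inner (integrable_lipschitz_comp_add_smul hLip hν₁ c x) v).symm
  · rw [LinearIsometryEquiv.norm_map]
    refine (norm_le_insert' _ (gf x)).trans ?_
    gcongr
    refine (hLip.norm_sub_le _ _).trans ?_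
    gcongr
    rw [add_sub_right_comm]
    refine (norm_add_le _ _).trans ?_
    rw [norm_smul, Real.norm_eq_abs]
    gcongr
    exact (mem_ball_iff_norm.1 hz).le

theorem LipschitzWith.integral_comp_add_smul {gf : E → E} {L : NNReal} (hLip : LipschitzWith L gf)
    (hν : Integrable (fun u : E ↦ ‖u‖) ν) (c : ℝ) :
    LipschitzWith L (fun x ↦ ∫ u, gf (x + c • u) ∂ν) := by
  refine LipschitzWith.of_dist_le_mul fun x y ↦ ?_
  rw [dist_eq_norm, ← integral_sub (integrable_lipschitz_comp_add_smul hLip hν c x)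
    (integrable_lipschitz_comp_add_smul hLip hν c y)]
  refine (norm_integral_le_of_norm_le_const (.of_forall fun u ↦ ?_)).trans_eq
    (by rw [probReal_univ, mul_one])
  simpa [← dist_eq_norm] using hLip.dist_le_mul (x + c • u) (y + c • u)

end Smoothing

theorem integral_exp_neg_mul_norm_sq_comp {E : Type*} [NormedAddCommGroup E]
    [InnerProductSpace ℝ E] [FiniteDimensional ℝ E] [MeasurableSpace E] [BorelSpace E]
    {T : E →ₗ[ℝ] E} (hT : LinearMap.det T ≠ 0) {b : ℝ} (hb : 0 < b) :
    ∫ u : E, Real.exp (-b * ‖T u‖ ^ 2) =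
      |(LinearMap.det T)⁻¹| * (Real.pi / b) ^ (Module.finrank ℝ E / 2 : ℝ) := by
  have hcont : Continuous T := T.continuous_of_finiteDimensional
  rw [← integral_map (f := fun v ↦ Real.exp (-b * ‖v‖ ^ 2)) hcont.aemeasurable
    (by fun_prop), Measure.map_linearMap_addHaar_eq_smul_addHaar volume hT, integral_smul_measure,
    GaussianFourier.integral_rexp_neg_mul_sq_norm hb, ENNReal.toReal_ofReal (abs_nonneg _),
    smul_eq_mul]

theorem integrable_exp_neg_mul_norm_sq_comp {E : Type*} [NormedAddCommGroup E]
    [InnerProductSpace ℝ E] [FiniteDimensional ℝ E] [MeasurableSpace E] [BorelSpace E]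
    {T : E →ₗ[ℝ] E} (hT : LinearMap.det T ≠ 0) {b : ℝ} (hb : 0 < b) :
    Integrable fun u : E ↦ Real.exp (-b * ‖T u‖ ^ 2) := by
  refine Integrable.of_integral_ne_zero ?_
  rw [integral_exp_neg_mul_norm_sq_comp hT hb]
  positivity

theorem integrable_norm_sq_mul_exp_neg_mul_norm_sq_comp {E : Type*} [NormedAddCommGroup E]
    [InnerProductSpace ℝ E] [FiniteDimensional ℝ E] [MeasurableSpace E] [BorelSpace E]
    {T : E →ₗ[ℝ] E} (hT : LinearMap.det T ≠ 0) {b : ℝ} (hb : 0 < b) :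
    Integrable fun u : E ↦ ‖u‖ ^ 2 * Real.exp (-b * ‖T u‖ ^ 2) := by
  have hcont : Continuous T := T.continuous_of_finiteDimensional
  obtain ⟨K, -, hK⟩ := T.exists_antilipschitzWith
    (LinearMap.isUnit_iff_ker_eq_bot T |>.1 ((LinearMap.isUnit_iff_isUnit_det T).2 hT.isUnit))
  refine ((integrable_exp_neg_mul_norm_sq_comp hT (half_pos hb)).const_mul
    (K ^ 2 * (2 / b))).mono' (by fun_prop) (.of_forall fun u ↦ ?_)
  have hu : ‖u‖ ≤ K * ‖T u‖ := by simpa using hK.le_mul_dist u 0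
  have hexp : ‖T u‖ ^ 2 ≤ 2 / b * Real.exp (b / 2 * ‖T u‖ ^ 2) := by
    have h := Real.add_one_le_exp (b / 2 * ‖T u‖ ^ 2)
    calc ‖T u‖ ^ 2 = 2 / b * (b / 2 * ‖T u‖ ^ 2) := by field_simp
      _ ≤ _ := by gcongr; linarith
  rw [Real.norm_of_nonneg (by positivity)]
  calc ‖u‖ ^ 2 * Real.exp (-b * ‖T u‖ ^ 2)
      ≤ (K * ‖T u‖) ^ 2 * Real.exp (-b * ‖T u‖ ^ 2) := by gcongr
    _ = K ^ 2 * ‖T u‖ ^ 2 * Real.exp (-b * ‖T u‖ ^ 2) := by ring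
    _ ≤ K ^ 2 * (2 / b * Real.exp (b / 2 * ‖T u‖ ^ 2)) * Real.exp (-b * ‖T u‖ ^ 2) := by gcongr
    _ = K ^ 2 * (2 / b) * Real.exp (-(b / 2) * ‖T u‖ ^ 2) := by
      rw [← mul_assoc, mul_assoc, ← Real.exp_add]
      ring_nf

theorem sum_sum_conjTranspose_mul_self_eq_norm_sq {ι : Type*} [Fintype ι] [DecidableEq ι]
    (A : Matrix ι ι ℝ) (u : EuclideanSpace ℝ ι) :
    ∑ i, ∑ j, u i * (A.conjTranspose * A) i j * u j = ‖A.toEuclideanLin u‖ ^ 2 := by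
  rw [EuclideanSpace.real_norm_sq_eq]
  have : ∀ i, (A.toEuclideanLin u) i = ∑ j, A i j * u j := fun i ↦ rfl
  simp_rw [this, sq, Finset.sum_mul_sum, Matrix.mul_apply, Finset.mul_sum, Finset.sum_mul]
  rw [Finset.sum_congr rfl fun _ _ ↦ Finset.sum_comm, Finset.sum_comm]
  refine Finset.sum_congr rfl fun k _ ↦ Finset.sum_congr rfl fun i _ ↦
    Finset.sum_congr rfl fun j _ ↦ ?_
  simp
  ring

theorem Matrix.PosDef.exists_quadratic_eq_norm_sq {ι : Type*} [Fintype ι] [DecidableEq ι]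
    {B : Matrix ι ι ℝ} (hB : B.PosDef) :
    ∃ T : EuclideanSpace ℝ ι →ₗ[ℝ] EuclideanSpace ℝ ι, LinearMap.det T ≠ 0 ∧
      B.det = LinearMap.det T ^ 2 ∧
      ∀ u : EuclideanSpace ℝ ι, ∑ i, ∑ j, u i * B i j * u j = ‖T u‖ ^ 2 := by
  open scoped MatrixOrder Matrix.Norms.L2Operator in
  obtain ⟨A, -, rfl⟩ := CStarAlgebra.isStrictlyPositive_iff_eq_star_mul_self.mp
    hB.isStrictlyPositive
  have hdet : LinearMap.det A.toEuclideanLin = A.det := by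
    rw [Matrix.toEuclideanLin_eq_toLin_orthonormal, LinearMap.det_toLin]
  have hsq : (star A * A).det = LinearMap.det A.toEuclideanLin ^ 2 := by
    rw [hdet, Matrix.det_mul, Matrix.star_eq_conjTranspose, Matrix.det_conjTranspose, star_trivial,
      sq]
  refine ⟨A.toEuclideanLin, fun h ↦ ?_, hsq, sum_sum_conjTranspose_mul_self_eq_norm_sq A⟩
  exact hB.det_pos.ne' (by rw [hsq, h, sq, zero_mul])

theorem sqrt_det_mul_integral_exp_neg_half_quadratic {n : ℕ} {B : Matrix (Fin n) (Fin n) ℝ}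
    (hB : B.PosDef) :
    Real.sqrt (B.det / (2 * Real.pi) ^ n) * ∫ u : EuclideanSpace ℝ (Fin n),
      Real.exp (-(1 / 2) * ∑ i, ∑ j, u i * B i j * u j) = 1 := by
  obtain ⟨T, hT, hdet, hTB⟩ := hB.exists_quadratic_eq_norm_sq
  simp_rw [hTB]
  have hpow : Real.sqrt ((2 * Real.pi) ^ n) = (2 * Real.pi) ^ (n / 2 : ℝ) := by
    rw [Real.sqrt_eq_rpow, ← Real.rpow_natCast, ← Real.rpow_mul (by positivity)]
    ring_nf
  rw [integral_exp_neg_mul_norm_sq_comp hT one_half_pos, hdet, Real.sqrt_div (sq_nonneg _),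
    Real.sqrt_sq_eq_abs, hpow, finrank_euclideanSpace_fin, abs_inv, div_div_eq_mul_div, div_one,
    mul_comm Real.pi 2]
  have := abs_pos.2 hT
  field_simp

theorem integrable_norm_sq_mul_exp_neg_half_quadratic {n : ℕ} {B : Matrix (Fin n) (Fin n) ℝ}
    (hB : B.PosDef) :
    Integrable fun u : EuclideanSpace ℝ (Fin n) ↦
      ‖u‖ ^ 2 * Real.exp (-(1 / 2) * ∑ i, ∑ j, u i * B i j * u j) := by
  obtain ⟨T, hT, -, hTB⟩ := hB.exists_quadratic_eq_norm_sq
  simp_rw [hTB]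
  exact integrable_norm_sq_mul_exp_neg_mul_norm_sq_comp hT one_half_pos

/-- If `f : ℝⁿ → ℝ` is differentiable with gradient `gf` that is Lipschitz
with constant `Lg`, then for every `μ > 0` and every symmetric positive-definite matrix `B`,
the Gaussian smoothed function `f_μ(x) = √(det B/(2π)ⁿ) ∫ f(x + μu) exp(-(1/2) uᵀBu) du` is
differentiable with gradient `∇f_μ(x) = √(det B/(2π)ⁿ) ∫ ∇f(x + μu) exp(-(1/2) uᵀBu) du`,
which is Lipschitz with constant at most `Lg`. -/
theorem gaussian_smoothing_gradient_lipschitz {n : ℕ}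
    (f : EuclideanSpace ℝ (Fin n) → ℝ)
    (gf : EuclideanSpace ℝ (Fin n) → EuclideanSpace ℝ (Fin n))
    (hgrad : ∀ x, HasGradientAt f (gf x) x)
    (Lg : NNReal) (hLip : LipschitzWith Lg gf)
    (B : Matrix (Fin n) (Fin n) ℝ) (hB : B.PosDef)
    (μ : ℝ) (hμ : 0 < μ) :
    (∀ x : EuclideanSpace ℝ (Fin n),
      HasGradientAt
        (fun z : EuclideanSpace ℝ (Fin n) =>
          Real.sqrt (B.det / (2 * Real.pi) ^ n) *
            ∫ u : EuclideanSpace ℝ (Fin n),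
              f (z + μ • u) * Real.exp (-(1 / 2) * ∑ i, ∑ j, u i * B i j * u j))
        (Real.sqrt (B.det / (2 * Real.pi) ^ n) •
          ∫ u : EuclideanSpace ℝ (Fin n),
            Real.exp (-(1 / 2) * ∑ i, ∑ j, u i * B i j * u j) • gf (x + μ • u))
        x) ∧
    LipschitzWith Lg (fun x : EuclideanSpace ℝ (Fin n) =>
      Real.sqrt (B.det / (2 * Real.pi) ^ n) •
        ∫ u : EuclideanSpace ℝ (Fin n),
          Real.exp (-(1 / 2) * ∑ i, ∑ j, u i * B i j * u j) • gf (x + μ • u)) := by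
  set k : ℝ := Real.sqrt (B.det / (2 * Real.pi) ^ n)
  set w : EuclideanSpace ℝ (Fin n) → ℝ :=
    fun u ↦ Real.exp (-(1 / 2) * ∑ i, ∑ j, u i * B i j * u j)
  have hw₀ (u) : 0 ≤ k * w u := by positivity
  have hmeas : Measurable fun u ↦ ENNReal.ofReal (k * w u) := by fun_prop
  have hfin : ∀ᵐ u : EuclideanSpace ℝ (Fin n), ENNReal.ofReal (k * w u) < ⊤ :=
    .of_forall fun _ ↦ ENNReal.ofReal_lt_top
  set ν : Measure (EuclideanSpace ℝ (Fin n)) :=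
    volume.withDensity fun u ↦ ENNReal.ofReal (k * w u) with hν
  have hone : ∫ u, k * w u = 1 := by
    rw [integral_const_mul]
    exact sqrt_det_mul_integral_exp_neg_half_quadratic hB
  have : IsProbabilityMeasure ν := ⟨by
    rw [hν, withDensity_apply _ .univ, Measure.restrict_univ, ← ofReal_integral_eq_lintegral_ofReal
      (.of_integral_ne_zero (hone.trans_ne one_ne_zero)) (.of_forall hw₀), hone,
      ENNReal.ofReal_one]⟩
  have hmoment : Integrable (fun u ↦ ‖u‖ ^ 2) ν := by
    rw [hν, integrable_withDensity_iff_integrable_smul' hmeas hfin]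
    refine ((integrable_norm_sq_mul_exp_neg_half_quadratic hB).const_mul k).congr
      (.of_forall fun u ↦ ?_)
    change k * (‖u‖ ^ 2 * w u) = (ENNReal.ofReal (k * w u)).toReal • ‖u‖ ^ 2
    rw [ENNReal.toReal_ofReal (hw₀ u), smul_eq_mul, mul_assoc, mul_comm (w u)]
  have hgradient (x) : ∫ u, gf (x + μ • u) ∂ν = k • ∫ u, w u • gf (x + μ • u) := by
    rw [hν, integral_withDensity_eq_integral_toReal_smul hmeas hfin, ← integral_smul]
    simp_rw [ENNReal.toReal_ofReal (hw₀ _), mul_smul]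
  have hvalue (x) : ∫ u, f (x + μ • u) ∂ν = k * ∫ u, f (x + μ • u) * w u := by
    rw [hν, integral_withDensity_eq_integral_toReal_smul hmeas hfin, ← integral_const_mul]
    simp_rw [ENNReal.toReal_ofReal (hw₀ _), smul_eq_mul, mul_assoc, mul_comm (w _)]
  have hderiv := hasGradientAt_integral_comp_add_smul hgrad hLip hmoment μ
  have hlipschitz := hLip.integral_comp_add_smul (integrable_norm_of_integrable_norm_sq hmoment) μ
  simp only [hgradient, hvalue] at hderiv hlipschitz
  exact ⟨hderiv, hlipschitz⟩
end

section
/- Let D ⊂ ℝⁿ be a finite set of nonzero vectors that positively spans ℝⁿ, i.e., every x ∈ ℝⁿ can be written as x = Σ_{d∈D} λ_d d with all λ_d ≥ 0. Then the cosine measure of D is positive: cm(D) = min_{v ∈ ℝⁿ, v ≠ 0} max_{d ∈ D} (dᵀv)/(‖d‖‖v‖) > 0. In particular, for every nonzero v ∈ ℝⁿ there exists d ∈ D with dᵀv > 0, so whenever ∇f(x) ≠ 0 some direction of D is a descent direction for a continuously differentiable f. -/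
open scoped RealInnerProductSpace

/-- A finite positive spanning set of a real inner product space meets every open half-space
`{d | 0 < ⟪d, v⟫}` with `v ≠ 0`. -/
theorem exists_inner_pos_of_nonneg_span {E : Type*} [NormedAddCommGroup E]
    [InnerProductSpace ℝ E] {D : Finset E}
    (hspan : ∀ x : E, ∃ lam : E → ℝ, (∀ d ∈ D, 0 ≤ lam d) ∧ x = ∑ d ∈ D, lam d • d)
    {v : E} (hv : v ≠ 0) : ∃ d ∈ D, 0 < ⟪d, v⟫ := by
  by_contra! h
  obtain ⟨lam, hlam, hsum⟩ := hspan v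
  have hpos : 0 < ⟪v, v⟫ := real_inner_self_pos.2 hv
  have hle : ⟪∑ d ∈ D, lam d • d, v⟫ ≤ 0 := by
    rw [sum_inner]
    refine Finset.sum_nonpos fun d hd => ?_
    rw [real_inner_smul_left]
    exact mul_nonpos_of_nonneg_of_nonpos (hlam d hd) (h d hd)
  rw [← hsum] at hle
  exact hpos.not_ge hle

/-- If a finite set of nonzero vectors in a finite-dimensional real inner product space meets
every open half-space bounded by a hyperplane through the origin, then the largest cosine of the
angle between a nonzero vector and an element of the set is bounded below by a positive
constant. -/
theorem exists_pos_le_sup'_cosine {E : Type*} [NormedAddCommGroup E]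
    [InnerProductSpace ℝ E] [FiniteDimensional ℝ E] {D : Finset E} (hD : D.Nonempty)
    (hnonzero : ∀ d ∈ D, d ≠ 0) (hpos : ∀ v : E, v ≠ 0 → ∃ d ∈ D, 0 < ⟪d, v⟫) :
    ∃ c : ℝ, 0 < c ∧ ∀ v : E, v ≠ 0 → c ≤ D.sup' hD fun d => ⟪d, v⟫ / (‖d‖ * ‖v‖) := by
  obtain ⟨e, he⟩ := id hD
  have : Nontrivial E := ⟨e, 0, hnonzero e he⟩
  have : ProperSpace E := FiniteDimensional.proper ℝ E
  have hcont : Continuous fun v : E => D.sup' hD fun d => ⟪d, v⟫ / ‖d‖ :=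
    Continuous.finset_sup'_apply hD fun d _ => by fun_prop
  obtain ⟨u, hu, hmin⟩ := (isCompact_sphere (0 : E) 1).exists_isMinOn
    (NormedSpace.sphere_nonempty.2 zero_le_one) hcont.continuousOn
  refine ⟨D.sup' hD fun d => ⟪d, u⟫ / ‖d‖, ?_, fun v hv => ?_⟩
  · obtain ⟨d, hd, hdu⟩ := hpos u (ne_zero_of_mem_unit_sphere ⟨u, hu⟩)
    exact (Finset.lt_sup'_iff hD).2 ⟨d, hd, div_pos hdu (norm_pos_iff.2 (hnonzero d hd))⟩
  · have hmem : ‖v‖⁻¹ • v ∈ Metric.sphere (0 : E) 1 := by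
      simpa using norm_smul_inv_norm (𝕜 := ℝ) hv
    refine (isMinOn_iff.1 hmin _ hmem).trans_eq ?_
    congr 1
    ext d
    rw [real_inner_smul_right, div_mul_eq_div_div, inv_mul_eq_div, div_right_comm]

/-- If `D` is a finite set of nonzero vectors that positively spans `ℝⁿ`,
then its cosine measure `cm(D) = min_{v ≠ 0} max_{d ∈ D} dᵀv/(‖d‖‖v‖)` is positive; in
particular, for every nonzero `v` there is `d ∈ D` with `dᵀv > 0`, so whenever
`∇f(x) ≠ 0` for a continuously differentiable `f`, some direction of `D` is a descent
direction. -/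
theorem positive_spanning_cosine_measure {n : ℕ}
    (D : Finset (EuclideanSpace ℝ (Fin n))) (hD : D.Nonempty)
    (hnonzero : ∀ d ∈ D, d ≠ 0)
    (hspan : ∀ x : EuclideanSpace ℝ (Fin n),
      ∃ lam : EuclideanSpace ℝ (Fin n) → ℝ,
        (∀ d ∈ D, 0 ≤ lam d) ∧ x = ∑ d ∈ D, lam d • d) :
    (0 < ⨅ v : {v : EuclideanSpace ℝ (Fin n) // v ≠ 0},
        D.sup' hD fun d =>
          ⟪d, (v : EuclideanSpace ℝ (Fin n))⟫ /
            (‖d‖ * ‖(v : EuclideanSpace ℝ (Fin n))‖)) ∧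
    (∀ v : EuclideanSpace ℝ (Fin n), v ≠ 0 → ∃ d ∈ D, 0 < ⟪d, v⟫) ∧
    (∀ f : EuclideanSpace ℝ (Fin n) → ℝ, ContDiff ℝ 1 f →
      ∀ x, gradient f x ≠ 0 → ∃ d ∈ D, ⟪gradient f x, d⟫ < 0) := by
  have hpos : ∀ v : EuclideanSpace ℝ (Fin n), v ≠ 0 → ∃ d ∈ D, 0 < ⟪d, v⟫ :=
    fun v hv => exists_inner_pos_of_nonneg_span hspan hv
  refine ⟨?_, hpos, fun f _ x hx => ?_⟩
  · obtain ⟨c, hc, hle⟩ := exists_pos_le_sup'_cosine hD hnonzero hpos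
    obtain ⟨e, he⟩ := id hD
    have : Nonempty {v : EuclideanSpace ℝ (Fin n) // v ≠ 0} := ⟨⟨e, hnonzero e he⟩⟩
    exact hc.trans_le (le_ciInf fun v => hle v v.2)
  · obtain ⟨d, hd, hdx⟩ := hpos (-gradient f x) (neg_ne_zero.2 hx)
    refine ⟨d, hd, ?_⟩
    rwa [inner_neg_right, neg_pos, real_inner_comm] at hdx
end
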